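/- arXiv:1202.5107 — 2 statements merged into one kernel-verified Lean document; each statement's English description precedes it below -/
import Mathlib

section
/- Small-argument asymptotics of K₀: define K₀(z) := ∫_0^∞ e^{−z cosh t} dt for z > 0 (the modified Bessel function of the second kind of order 0 in its standard integral representation). Then K₀(z) is finite for every z > 0 and lim_{z→0⁺} ( K₀(z) + log(z/2) + γ ) = 0, where γ is the Euler–Mascheroni constant; i.e. K₀(z) = −log(z/2) − γ + o(1) as z → 0⁺. -/
open MeasureTheory Filter Topology

/-- The modified Bessel function of the second kind of order 0 in its standard
integral representation: `K₀(z) = ∫_0^∞ e^(−z cosh t) dt`. -/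
noncomputable def besselK0 (z : ℝ) : ℝ :=
  ∫ t in Set.Ioi (0 : ℝ), Real.exp (-z * Real.cosh t)

lemma k0_int (z : ℝ) (hz : 0 < z) :
    IntegrableOn (fun t : ℝ => Real.exp (-z * Real.cosh t)) (Set.Ioi 0) := by
  refine Integrable.mono' ((integrableOn_exp_neg_Ioi 0).const_mul (2 / z))
    (by fun_prop) (ae_of_all _ fun t => ?_)
  rw [Real.norm_of_nonneg (Real.exp_pos _).le]
  have h1 : Real.exp t / 2 ≤ Real.cosh t := by
    rw [Real.cosh_eq]; linarith [Real.exp_pos (-t)]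
  have h2 : z * (Real.exp t / 2) ≤ z * Real.cosh t := by gcongr
  have h3 : 0 < z * (Real.exp t / 2) := by positivity
  have h4 : z * (Real.exp t / 2) ≤ Real.exp (z * Real.cosh t) := by
    linarith [Real.add_one_le_exp (z * Real.cosh t)]
  rw [neg_mul, Real.exp_neg, Real.exp_neg]
  calc (Real.exp (z * Real.cosh t))⁻¹ ≤ (z * (Real.exp t / 2))⁻¹ := inv_anti₀ h3 h4
    _ = 2 / z * (Real.exp t)⁻¹ := by field_simp

lemma k0_gamma_log :
    ∫ s : ℝ, s * Real.exp s * Real.exp (-Real.exp s) = -Real.eulerMascheroniConstant := by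
  have h1 : HasDerivAt Complex.Gamma
      (∫ (t : ℝ) in Set.Ioi 0, (t : ℂ) ^ ((1 : ℂ) - 1) * (↑(Real.log t) * ↑(Real.exp (-t)))) 1 := by
    apply (Complex.hasDerivAt_GammaIntegral (s := 1) (by simp)).congr_of_eventuallyEq
    have : ∀ᶠ s : ℂ in 𝓝 1, 0 < s.re :=
      (isOpen_lt continuous_const Complex.continuous_re).mem_nhds (by simp)
    filter_upwards [this] with s hs using Complex.Gamma_eq_integral hs
  have h2 := h1.unique Complex.hasDerivAt_Gamma_one
  have h3 : ∫ t in Set.Ioi (0 : ℝ), Real.log t * Real.exp (-t)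
      = -Real.eulerMascheroniConstant := by
    have : ((∫ t in Set.Ioi (0 : ℝ), Real.log t * Real.exp (-t) : ℝ) : ℂ)
        = ((-Real.eulerMascheroniConstant : ℝ) : ℂ) := by
      rw [Complex.ofReal_neg, ← h2]
      refine integral_ofReal.symm.trans ?_
      simp
    exact_mod_cast this
  rw [← h3, ← Real.range_exp, ← Set.image_univ,
    integral_image_eq_integral_abs_deriv_smul MeasurableSet.univ
      (fun x _ => (Real.hasDerivAt_exp x).hasDerivWithinAt) Real.exp_injective.injOn]
  simp only [Measure.restrict_univ, Real.log_exp, smul_eq_mul, abs_of_pos (Real.exp_pos _)]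
  congr 1; ext s; ring

lemma k0_int_pos : IntegrableOn (fun s : ℝ => Real.exp (-Real.exp s)) (Set.Ioi 0) := by
  refine Integrable.mono' (integrableOn_exp_neg_Ioi 0) (by fun_prop) (ae_of_all _ fun t => ?_)
  rw [Real.norm_of_nonneg (Real.exp_pos _).le]
  exact Real.exp_le_exp.2 (by linarith [Real.add_one_le_exp t])

lemma k0_int_neg : IntegrableOn (fun s : ℝ => Real.exp (-Real.exp s) - 1) (Set.Iic 0) := by
  refine Integrable.mono' (integrableOn_exp_Iic 0) (by fun_prop) (ae_of_all _ fun t => ?_)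
  rw [Real.norm_eq_abs, abs_le]
  have := Real.add_one_le_exp (-Real.exp t)
  have h2 : Real.exp (-Real.exp t) ≤ 1 := by simp [Real.exp_nonneg]
  constructor <;> linarith [Real.exp_pos t]

lemma k0_bd_pos (s : ℝ) (hs : 0 < s) :
    s * Real.exp s * Real.exp (-Real.exp s) ≤ 6 * Real.exp (-s) := by
  have h := Real.pow_div_factorial_le_exp (Real.exp s) (Real.exp_pos s).le 3
  have h1 : s ≤ Real.exp s := by linarith [Real.add_one_le_exp s]
  have hx := Real.exp_pos s
  simp only [Nat.factorial] at h
  norm_num at h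
  rw [Real.exp_neg, Real.exp_neg, ← div_eq_mul_inv, ← div_eq_mul_inv,
    div_le_div_iff₀ (Real.exp_pos _) hx]
  calc s * Real.exp s * Real.exp s ≤ Real.exp s * Real.exp s * Real.exp s := by gcongr
    _ ≤ 6 * Real.exp (Real.exp s) := by nlinarith

lemma k0_int_pos' :
    IntegrableOn (fun s : ℝ => s * Real.exp s * Real.exp (-Real.exp s)) (Set.Ioi 0) := by
  refine Integrable.mono' ((integrableOn_exp_neg_Ioi 0).const_mul 6) (by fun_prop) ?_
  filter_upwards [ae_restrict_mem measurableSet_Ioi] with s hs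
  have hs : 0 < s := hs
  rw [Real.norm_of_nonneg (by positivity)]
  exact k0_bd_pos s hs

lemma k0_bd_neg (s : ℝ) (hs : s ≤ 0) : -s * Real.exp s ≤ 2 * Real.exp (1 / 2 * s) := by
  have h := Real.add_one_le_exp (-(1 / 2 * s))
  have h2 : Real.exp s = Real.exp (1 / 2 * s) * Real.exp (1 / 2 * s) := by
    rw [← Real.exp_add]; ring_nf
  have h3 : Real.exp (-(1 / 2 * s)) * Real.exp (1 / 2 * s) = 1 := by
    rw [← Real.exp_add]; simp
  have h4 := Real.exp_pos (1 / 2 * s)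
  have h5 : -s * Real.exp (1 / 2 * s) ≤ 2 := by nlinarith
  rw [h2]
  nlinarith

lemma k0_int_neg' :
    IntegrableOn (fun s : ℝ => s * Real.exp s * Real.exp (-Real.exp s)) (Set.Iic 0) := by
  refine Integrable.mono'
    ((integrableOn_exp_mul_Iic (a := 1 / 2) (by norm_num) 0).const_mul 2) (by fun_prop) ?_
  filter_upwards [ae_restrict_mem measurableSet_Iic] with s hs
  have hs : s ≤ 0 := hs
  have h2 : Real.exp (-Real.exp s) ≤ 1 := by simp [Real.exp_nonneg]
  rw [norm_mul, norm_mul, Real.norm_of_nonneg (Real.exp_pos _).le,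
    Real.norm_of_nonneg (Real.exp_pos _).le, Real.norm_of_nonpos hs]
  calc -s * Real.exp s * Real.exp (-Real.exp s) ≤ -s * Real.exp s * 1 := by
        gcongr
        exact mul_nonneg (by linarith) (Real.exp_pos _).le
    _ ≤ _ := by rw [mul_one]; exact k0_bd_neg s hs

lemma k0_deriv (a s : ℝ) : HasDerivAt (fun s : ℝ => s * (Real.exp (-Real.exp s) - a))
    ((Real.exp (-Real.exp s) - a) - s * Real.exp s * Real.exp (-Real.exp s)) s := by
  have := (hasDerivAt_id s).mul (((Real.hasDerivAt_exp s).neg.exp).sub_const a)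
  refine this.congr_deriv ?_
  simp; ring

lemma k0_tend_pos : Tendsto (fun s : ℝ => s * (Real.exp (-Real.exp s) - 0)) atTop (𝓝 0) := by
  have h : Tendsto (fun s : ℝ => 6 * Real.exp (-s)) atTop (𝓝 0) := by
    simpa using (Real.tendsto_exp_neg_atTop_nhds_zero).const_mul 6
  refine squeeze_zero' ?_ ?_ h
  · filter_upwards [eventually_gt_atTop 0] with s hs
    rw [sub_zero]; positivity
  · filter_upwards [eventually_gt_atTop 0] with s hs
    refine le_trans ?_ (k0_bd_pos s hs)
    rw [sub_zero]
    gcongr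
    have := Real.add_one_le_exp s
    nlinarith

lemma k0_tend_neg : Tendsto (fun s : ℝ => s * (Real.exp (-Real.exp s) - 1)) atBot (𝓝 0) := by
  have h : Tendsto (fun s : ℝ => 2 * Real.exp (1 / 2 * s)) atBot (𝓝 0) := by
    simpa using (Real.tendsto_exp_atBot.comp
      (tendsto_id.const_mul_atBot (by norm_num : (0 : ℝ) < 1 / 2))).const_mul 2
  refine squeeze_zero' ?_ ?_ h
  · filter_upwards [eventually_le_atBot 0] with s hs
    have h2 : Real.exp (-Real.exp s) ≤ 1 := by simp [Real.exp_nonneg]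
    nlinarith
  · filter_upwards [eventually_le_atBot 0] with s hs
    refine le_trans ?_ (k0_bd_neg s hs)
    have := Real.add_one_le_exp (-Real.exp s)
    nlinarith

lemma k0_const : (∫ s in Set.Iic (0 : ℝ), (Real.exp (-Real.exp s) - 1))
    + ∫ s in Set.Ioi (0 : ℝ), Real.exp (-Real.exp s) = -Real.eulerMascheroniConstant := by
  have hA := integral_Iic_of_hasDerivAt_of_tendsto' (a := 0) (fun x _ => k0_deriv 1 x)
    (k0_int_neg.sub k0_int_neg') k0_tend_neg
  have hB := integral_Ioi_of_hasDerivAt_of_tendsto' (a := 0) (fun x _ => k0_deriv 0 x)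
    (by
      simp only [sub_zero]
      exact k0_int_pos.sub k0_int_pos') k0_tend_pos
  rw [integral_sub k0_int_neg k0_int_neg'] at hA
  simp only [sub_zero] at hB
  rw [integral_sub k0_int_pos k0_int_pos'] at hB
  have hC := intervalIntegral.integral_Iic_add_Ioi k0_int_neg' k0_int_pos'
  rw [k0_gamma_log] at hC
  simp only [zero_mul, sub_zero] at hA hB
  linarith

/-- The shifted integrand. -/
noncomputable def k0g (c s : ℝ) : ℝ := Real.exp (-(Real.exp s + Real.exp (-s - 2 * c)))

lemma k0g_cont (c : ℝ) : Continuous (k0g c) := by unfold k0g; fun_prop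

lemma k0g_le (c s : ℝ) : k0g c s ≤ Real.exp (-Real.exp s) :=
  Real.exp_le_exp.2 (by linarith [Real.exp_pos (-s - 2 * c)])

lemma k0g_tend (s : ℝ) : Tendsto (fun c => k0g c s) atTop (𝓝 (Real.exp (-Real.exp s))) := by
  have h : Tendsto (fun c : ℝ => Real.exp (-s - 2 * c)) atTop (𝓝 0) := by
    refine Real.tendsto_exp_atBot.comp ?_
    have := tendsto_atBot_add_const_left atTop (-s)
      (tendsto_neg_atTop_atBot.comp (tendsto_id.const_mul_atTop (by norm_num : (0 : ℝ) < 2)))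
    exact this
  have := (Real.continuous_exp.tendsto _).comp ((h.const_add (Real.exp s)).neg)
  rw [add_zero] at this
  exact this

lemma k0g_int_pos (c : ℝ) : IntegrableOn (k0g c) (Set.Ioi 0) := by
  refine Integrable.mono' k0_int_pos (k0g_cont c).aestronglyMeasurable (ae_of_all _ fun s => ?_)
  rw [Real.norm_of_nonneg (show 0 ≤ k0g c s from (Real.exp_pos _).le)]
  exact k0g_le c s

lemma k0_shift (c : ℝ) : besselK0 (2 * Real.exp (-c)) = ∫ s in Set.Ioi (-c), k0g c s := by
  have h := (measurePreserving_add_right volume c).setIntegral_preimage_emb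
    (measurableEmbedding_addRight c)
    (fun t => Real.exp (-(2 * Real.exp (-c)) * Real.cosh t)) (Set.Ioi 0)
  unfold besselK0
  rw [← h]
  have : (fun x => x + c) ⁻¹' Set.Ioi 0 = Set.Ioi (-c) := by
    ext x; simp [neg_lt_iff_pos_add]
  rw [this]
  congr 1; ext s
  unfold k0g
  congr 1
  have e1 : Real.exp s = Real.exp (-c) * Real.exp (s + c) := by
    rw [← Real.exp_add]; ring_nf
  have e2 : Real.exp (-s - 2 * c) = Real.exp (-c) * Real.exp (-(s + c)) := by
    rw [← Real.exp_add]; ring_nf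
  rw [Real.cosh_eq, e1, e2]
  ring

lemma k0_split (c : ℝ) (hc : 0 ≤ c) : besselK0 (2 * Real.exp (-c)) - c
    = (∫ s in Set.Iic (0 : ℝ), (Set.Ioi (-c)).indicator (fun s => k0g c s - 1) s)
      + ∫ s in Set.Ioi (0 : ℝ), k0g c s := by
  rw [k0_shift, ← Set.Ioc_union_Ioi_eq_Ioi (show -c ≤ 0 by linarith),
    setIntegral_union (Set.Ioc_disjoint_Ioi le_rfl) measurableSet_Ioi
      ((k0g_cont c).integrableOn_Ioc) (k0g_int_pos c)]
  rw [Set.Ioc_union_Ioi_eq_Ioi (show -c ≤ 0 by linarith),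
    setIntegral_indicator measurableSet_Ioi, Set.inter_comm, Set.Ioi_inter_Iic,
    integral_sub ((k0g_cont c).integrableOn_Ioc) (by simp)]
  simp [hc]
  ring

lemma k0_lim : Tendsto (fun c : ℝ => besselK0 (2 * Real.exp (-c)) - c) atTop
    (𝓝 (-Real.eulerMascheroniConstant)) := by
  rw [← k0_const]
  have key : Tendsto (fun c : ℝ =>
      (∫ s in Set.Iic (0 : ℝ), (Set.Ioi (-c)).indicator (fun s => k0g c s - 1) s)
      + ∫ s in Set.Ioi (0 : ℝ), k0g c s) atTop
      (𝓝 ((∫ s in Set.Iic (0 : ℝ), (Real.exp (-Real.exp s) - 1))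
        + ∫ s in Set.Ioi (0 : ℝ), Real.exp (-Real.exp s))) := by
    refine Tendsto.add ?_ ?_
    · refine tendsto_integral_filter_of_dominated_convergence (fun s => 2 * Real.exp s)
        (Eventually.of_forall fun c => ?_) (Eventually.of_forall fun c => ae_of_all _ fun s => ?_)
        ((integrableOn_exp_Iic 0).const_mul 2) (ae_of_all _ fun s => ?_)
      · exact (((k0g_cont c).sub continuous_const).measurable.indicator
          measurableSet_Ioi).aestronglyMeasurable
      · by_cases hs : s ∈ Set.Ioi (-c)
        · rw [Set.indicator_of_mem hs]
          have hs : -c < s := hs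
          have h1 := k0g_le c s
          have h2 : Real.exp (-Real.exp s) ≤ 1 := by simp [Real.exp_nonneg]
          have h3 : Real.exp (-s - 2 * c) ≤ Real.exp s := Real.exp_le_exp.2 (by linarith)
          have h4 := Real.add_one_le_exp (-(Real.exp s + Real.exp (-s - 2 * c)))
          change _ ≤ k0g c s at h4
          rw [Real.norm_eq_abs, abs_le]
          constructor <;> linarith [Real.exp_pos s]
        · rw [Set.indicator_of_notMem hs, norm_zero]; positivity
      · refine ((k0g_tend s).sub_const 1).congr' ?_
        filter_upwards [eventually_gt_atTop (-s)] with c hc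
        rw [Set.indicator_of_mem]
        show -c < s
        linarith
    · refine tendsto_integral_filter_of_dominated_convergence (fun s => Real.exp (-Real.exp s))
        (Eventually.of_forall fun c => (k0g_cont c).aestronglyMeasurable)
        (Eventually.of_forall fun c => ae_of_all _ fun s => ?_)
        k0_int_pos (ae_of_all _ fun s => k0g_tend s)
      rw [Real.norm_of_nonneg (show 0 ≤ k0g c s from (Real.exp_pos _).le)]
      exact k0g_le c s
  refine key.congr' ?_
  filter_upwards [eventually_ge_atTop 0] with c hc using (k0_split c hc).symm

theorem stmt_8 :
    (∀ z : ℝ, 0 < z →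
      IntegrableOn (fun t : ℝ => Real.exp (-z * Real.cosh t)) (Set.Ioi 0)) ∧
    Tendsto (fun z : ℝ => besselK0 z + Real.log (z / 2) + Real.eulerMascheroniConstant)
      (𝓝[>] 0) (𝓝 0) := by
  refine ⟨k0_int, ?_⟩
  have hh : Tendsto (fun z : ℝ => z / 2) (𝓝[>] 0) (𝓝[>] 0) := by
    refine tendsto_nhdsWithin_iff.2 ⟨?_, ?_⟩
    · have : Tendsto (fun z : ℝ => z / 2) (𝓝 0) (𝓝 (0 / 2)) :=
        (continuous_id.div_const 2).tendsto 0
      rw [zero_div] at this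
      exact this.mono_left nhdsWithin_le_nhds
    · filter_upwards [self_mem_nhdsWithin] with z hz
      exact half_pos (show (0 : ℝ) < z from hz)
  have hc : Tendsto (fun z : ℝ => -Real.log (z / 2)) (𝓝[>] 0) atTop :=
    tendsto_neg_atBot_atTop.comp (Real.tendsto_log_nhdsGT_zero.comp hh)
  have h := (k0_lim.comp hc).add_const Real.eulerMascheroniConstant
  rw [neg_add_cancel] at h
  refine h.congr' ?_
  filter_upwards [self_mem_nhdsWithin] with z hz
  have hz : 0 < z := hz
  simp only [Function.comp, neg_neg, sub_neg_eq_add]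
  rw [Real.exp_log (half_pos hz), mul_div_cancel₀ z two_ne_zero]
end

section
/- Uniform approximation of continuous functions by real-analytic functions (Whitney): for every continuous function f : ℝⁿ → ℝ and every ε > 0 there exists a function g : ℝⁿ → ℝ which is real-analytic at every point of ℝⁿ and satisfies |f(x) − g(x)| ≤ ε for all x ∈ ℝⁿ. -/
open MeasureTheory Filter Topology

theorem laplace_analytic {Ω V : Type*} [MeasurableSpace Ω] [NormedAddCommGroup V]
    [NormedSpace ℝ V] (μ : Measure Ω) (b : Ω → ℝ) (hb : AEStronglyMeasurable b μ)
    (L : Ω → V →L[ℝ] ℝ) (hL : AEStronglyMeasurable L μ)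
    (hint : ∀ R : ℝ, 0 ≤ R → Integrable (fun ω => |b ω| * Real.exp (R * ‖L ω‖)) μ) (v : V) :
    AnalyticAt ℝ (fun v => ∫ ω, b ω * Real.exp (L ω v) ∂μ) v := by
  let T : (m : ℕ) → Ω → ContinuousMultilinearMap ℝ (fun _ : Fin m => V) ℝ := fun m ω =>
    (b ω * (m.factorial : ℝ)⁻¹) • (ContinuousMultilinearMap.mkPiAlgebraFin ℝ m ℝ).compContinuousLinearMap
      (fun _ => L ω)
  have hTm : ∀ m, AEStronglyMeasurable (T m) μ := by
    intro m
    refine (hb.mul_const _).smul ?_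
    have hc : Continuous (fun l : V →L[ℝ] ℝ =>
        (ContinuousMultilinearMap.mkPiAlgebraFin ℝ m ℝ).compContinuousLinearMap (fun _ => l)) := by
      have h1 := (ContinuousMultilinearMap.compContinuousLinearMapContinuousMultilinear ℝ
        (fun _ : Fin m => V) (fun _ : Fin m => ℝ) ℝ).cont
      have h2 : Continuous (fun l : V →L[ℝ] ℝ => (fun _ : Fin m => l)) := by fun_prop
      exact ((h1.comp h2).clm_apply continuous_const)
    exact hc.comp_aestronglyMeasurable hL
  have hTn : ∀ m ω, ‖T m ω‖ ≤ |b ω| * (‖L ω‖ ^ m / m.factorial) := by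
    intro m ω
    simp only [T, norm_smul]
    have := ContinuousMultilinearMap.norm_compContinuousLinearMap_le
      (ContinuousMultilinearMap.mkPiAlgebraFin ℝ m ℝ) (fun _ => L ω)
    simp at this
    rw [norm_mul, Real.norm_eq_abs, norm_inv, Real.norm_natCast, mul_assoc, div_eq_inv_mul]
    gcongr
  have hgen : ∀ R : ℝ, 0 ≤ R → ∀ m ω, |b ω| * (‖L ω‖ ^ m / m.factorial) * R ^ m ≤
      (1 / 2) ^ m * (|b ω| * Real.exp (2 * R * ‖L ω‖)) := by
    intro R hR m ω
    have := Real.pow_div_factorial_le_exp (2 * R * ‖L ω‖) (by positivity) m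
    calc |b ω| * (‖L ω‖ ^ m / m.factorial) * R ^ m
        = (1 / 2) ^ m * (|b ω| * ((2 * R * ‖L ω‖) ^ m / m.factorial)) := by
          simp only [mul_pow, one_div, inv_pow]; field_simp
      _ ≤ _ := by gcongr
  have hTi : ∀ m, Integrable (T m) μ := by
    intro m
    refine ((hint 2 (by norm_num)).const_mul ((1 / 2) ^ m)).mono' (hTm m) (ae_of_all _ fun ω => ?_)
    have := hgen 1 zero_le_one m ω
    simp only [one_pow, mul_one] at this
    exact (hTn m ω).trans this
  let P : FormalMultilinearSeries ℝ V ℝ := fun m => ∫ ω, T m ω ∂μ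
  have key : HasFPowerSeriesOnBall (fun v => ∫ ω, b ω * Real.exp (L ω v) ∂μ) P 0 ⊤ := by
    refine ⟨?_, by simp, ?_⟩
    · rw [P.radius_eq_top_of_summable_norm]
      intro r
      refine Summable.of_nonneg_of_le (fun m => by positivity) (fun m => ?_)
        ((summable_geometric_two).mul_right (∫ ω, |b ω| * Real.exp (2 * r * ‖L ω‖) ∂μ))
      calc ‖P m‖ * (r : ℝ) ^ m ≤ (∫ ω, ‖T m ω‖ ∂μ) * (r : ℝ) ^ m := by
            gcongr; exact norm_integral_le_integral_norm _
        _ = ∫ ω, ‖T m ω‖ * (r : ℝ) ^ m ∂μ := (integral_mul_const _ _).symm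
        _ ≤ ∫ ω, (1 / 2) ^ m * (|b ω| * Real.exp (2 * r * ‖L ω‖)) ∂μ := by
            refine integral_mono ((hTi m).norm.mul_const _)
              ((hint _ (by positivity)).const_mul _) fun ω => ?_
            refine le_trans ?_ (hgen r r.2 m ω)
            have := hTn m ω
            dsimp only
            gcongr
        _ = _ := integral_const_mul _ _
    · intro y _
      simp only [zero_add]
      have hP : ∀ m, P m (fun _ => y) = ∫ ω, T m ω (fun _ => y) ∂μ := fun m =>
        ContinuousMultilinearMap.integral_apply (hTi m) _
      have hTy : ∀ m ω, T m ω (fun _ => y) = b ω * ((L ω y) ^ m / m.factorial) := by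
        intro m ω
        simp [T, div_eq_inv_mul, mul_assoc]
      have hs : ∀ ω, HasSum (fun m => T m ω (fun _ => y)) (b ω * Real.exp (L ω y)) := by
        intro ω
        simp only [hTy]
        refine HasSum.mul_left _ ?_
        rw [Real.exp_eq_exp_ℝ]
        exact NormedSpace.expSeries_div_hasSum_exp _
      simp only [hP]
      have hi : ∀ m, Integrable (fun ω => T m ω (fun _ => y)) μ := fun m =>
        (ContinuousMultilinearMap.apply ℝ (fun _ : Fin m => V) ℝ (fun _ => y)).integrable_comp (hTi m)
      have := hasSum_integral_of_summable_integral_norm (μ := μ)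
        (F := fun m ω => T m ω (fun _ => y)) hi ?_
      · convert this using 2
        exact funext fun ω => (hs ω).tsum_eq.symm
      · refine Summable.of_nonneg_of_le (fun m => by positivity) (fun m => ?_)
          ((summable_geometric_two).mul_right (∫ ω, |b ω| * Real.exp (2 * ‖y‖ * ‖L ω‖) ∂μ))
        rw [← integral_const_mul]
        refine integral_mono (hi m).norm ((hint _ (by positivity)).const_mul _) fun ω => ?_
        refine le_trans ?_ (hgen ‖y‖ (norm_nonneg _) m ω)
        have := (T m ω).le_opNorm (fun _ => y)
        simp only [Finset.prod_const, Finset.card_univ, Fintype.card_fin] at this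
        refine this.trans ?_
        gcongr
        exact hTn m ω
  exact key.analyticAt_of_mem (by simp)
theorem gauss_integrable (n : ℕ) :
    Integrable (fun v : EuclideanSpace ℝ (Fin n) => Real.exp (-‖v‖ ^ 2)) := by
  have h := (GaussianFourier.integrable_cexp_neg_mul_sq_norm_add (V := EuclideanSpace ℝ (Fin n))
    (b := 1) (by simp) 0 0).norm
  refine h.congr (ae_of_all _ fun v => ?_)
  simp only [Complex.norm_exp]
  congr 1
  simp [← Complex.ofReal_pow]

theorem gauss_pos (n : ℕ) :
    0 < ∫ v : EuclideanSpace ℝ (Fin n), Real.exp (-‖v‖ ^ 2) := by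
  have := GaussianFourier.integral_rexp_neg_mul_sq_norm (V := EuclideanSpace ℝ (Fin n))
    (b := 1) one_pos
  simp only [neg_mul, one_mul] at this
  rw [this]
  positivity

theorem gauss_approx {n : ℕ} (φ : EuclideanSpace ℝ (Fin n) → ℝ) (hφ : Continuous φ)
    (hc : HasCompactSupport φ) (η : ℝ) (hη : 0 < η) :
    ∀ᶠ σ : ℝ in atTop, ∀ x, |φ x - ∫ y, φ y *
      ((∫ v : EuclideanSpace ℝ (Fin n), Real.exp (-‖v‖ ^ 2))⁻¹ * σ ^ n) *
        Real.exp (-(σ ^ 2 * ‖x - y‖ ^ 2))| ≤ η := by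
  set Z := ∫ v : EuclideanSpace ℝ (Fin n), Real.exp (-‖v‖ ^ 2) with hZ
  have hZpos : 0 < Z := gauss_pos n
  have huc : UniformContinuous φ := hφ.uniformContinuous_of_tendsto_cocompact hc.is_zero_at_infty
  obtain ⟨C, hC⟩ := hc.exists_bound_of_continuous hφ
  have hlim : Tendsto (fun p : ℝ × EuclideanSpace ℝ (Fin n) =>
      ∫ v : EuclideanSpace ℝ (Fin n), Real.exp (-‖v‖ ^ 2) * (φ (p.2 + p.1⁻¹ • v) - φ p.2))
      (atTop ×ˢ ⊤) (𝓝 (∫ v : EuclideanSpace ℝ (Fin n), 0)) := by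
    refine tendsto_integral_filter_of_dominated_convergence
      (fun v => Real.exp (-‖v‖ ^ 2) * (C + C)) ?_ ?_ ((gauss_integrable n).mul_const _) ?_
    · refine Eventually.of_forall fun p => Continuous.aestronglyMeasurable (by fun_prop)
    · refine Eventually.of_forall fun p => ae_of_all _ fun v => ?_
      rw [norm_mul, Real.norm_of_nonneg (Real.exp_pos _).le]
      gcongr
      exact (norm_sub_le _ _).trans (add_le_add (hC _) (hC _))
    · refine ae_of_all _ fun v => ?_
      rw [show (0 : ℝ) = Real.exp (-‖v‖ ^ 2) * 0 by simp]
      refine Tendsto.const_mul _ ?_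
      rw [Metric.tendsto_nhds]
      intro e he
      obtain ⟨d, hd, hd'⟩ := Metric.uniformContinuous_iff.1 huc e he
      have h0 : Tendsto (fun σ : ℝ => σ⁻¹ • v) atTop (𝓝 ((0 : ℝ) • v)) :=
        tendsto_inv_atTop_zero.smul_const v
      rw [zero_smul] at h0
      have h1 := (Metric.tendsto_nhds.1 h0 d hd).prod_inl
        (⊤ : Filter (EuclideanSpace ℝ (Fin n)))
      filter_upwards [h1] with p hp
      have := hd' (a := p.2 + p.1⁻¹ • v) (b := p.2) (by simpa [dist_eq_norm] using hp)
      simpa [dist_eq_norm] using this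
  rw [integral_zero] at hlim
  have h2 := Metric.tendsto_nhds.1 hlim (η * Z) (by positivity)
  rw [← principal_univ] at h2
  rw [eventually_prod_principal_iff] at h2
  filter_upwards [h2, eventually_gt_atTop 0] with σ hσ hσ0 x
  have h3 := hσ x (Set.mem_univ x)
  have hi1 : Integrable (fun v : EuclideanSpace ℝ (Fin n) =>
      Real.exp (-‖v‖ ^ 2) * φ (x + σ⁻¹ • v)) :=
    (gauss_integrable n).mul_bdd (c := C) (Continuous.aestronglyMeasurable (by fun_prop))
      (ae_of_all _ fun v => hC _)
  have hi2 : Integrable (fun v : EuclideanSpace ℝ (Fin n) =>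
      Real.exp (-‖v‖ ^ 2) * φ x) := (gauss_integrable n).mul_const _
  simp only [mul_sub] at h3
  rw [integral_sub hi1 hi2, integral_mul_const, ← hZ] at h3
  have hcv : ∫ v : EuclideanSpace ℝ (Fin n), Real.exp (-‖v‖ ^ 2) * φ (x + σ⁻¹ • v)
      = σ ^ n * ∫ y, φ y * Real.exp (-(σ ^ 2 * ‖x - y‖ ^ 2)) := by
    have e1 := Measure.integral_comp_inv_smul_of_nonneg
      (volume : Measure (EuclideanSpace ℝ (Fin n)))
      (fun w => φ (x + w) * Real.exp (-(σ ^ 2 * ‖w‖ ^ 2))) hσ0.le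
    have e2 := integral_add_left_eq_self (μ := (volume : Measure (EuclideanSpace ℝ (Fin n))))
      (fun y => φ y * Real.exp (-(σ ^ 2 * ‖x - y‖ ^ 2))) x
    simp only [sub_add_cancel_left, norm_neg] at e2
    rw [e2, finrank_euclideanSpace_fin, smul_eq_mul] at e1
    rw [← e1]
    refine integral_congr_ae (ae_of_all _ fun v => ?_)
    simp only [norm_smul, norm_inv, Real.norm_of_nonneg hσ0.le]
    rw [mul_comm]
    congr 2
    field_simp
  rw [hcv] at h3
  have e4 : ∫ y, φ y * (Z⁻¹ * σ ^ n) * Real.exp (-(σ ^ 2 * ‖x - y‖ ^ 2))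
      = Z⁻¹ * (σ ^ n * ∫ y, φ y * Real.exp (-(σ ^ 2 * ‖x - y‖ ^ 2))) := by
    rw [← mul_assoc, ← integral_const_mul]
    congr 1 with y
    ring
  rw [e4]
  set I := σ ^ n * ∫ y, φ y * Real.exp (-(σ ^ 2 * ‖x - y‖ ^ 2))
  rw [Real.dist_eq, sub_zero] at h3
  rw [show φ x - Z⁻¹ * I = -(Z⁻¹ * (I - Z * φ x)) by field_simp; ring, abs_neg, abs_mul,
    abs_of_pos (inv_pos.2 hZpos), inv_mul_le_iff₀ hZpos]
  linarith [h3.le]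

/-- tent cutoff -/
noncomputable def cutoff (k : ℕ) (r : ℝ) : ℝ := min 1 (max 0 (k - r))

theorem partition_exists {n : ℕ} (f : EuclideanSpace ℝ (Fin n) → ℝ) (hf : Continuous f) :
    ∃ φ : ℕ → EuclideanSpace ℝ (Fin n) → ℝ, (∀ k, Continuous (φ k)) ∧
      (∀ k, HasCompactSupport (φ k)) ∧ (∀ (k : ℕ) x, ‖x‖ < (k : ℝ) - 1 → φ k x = 0) ∧
      ∀ x, HasSum (fun k => φ k x) (f x) := by
  have hsm : ∀ (k : ℕ) (r : ℝ), r ≤ k - 1 → cutoff k r = 1 := by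
    intro k r h
    rw [cutoff, max_eq_right (by linarith), min_eq_left (by linarith)]
  have hla : ∀ (k : ℕ) (r : ℝ), (k : ℝ) ≤ r → cutoff k r = 0 := by
    intro k r h
    rw [cutoff, max_eq_left (by linarith), min_eq_right (by linarith)]
  have hz : ∀ (k : ℕ) (x : EuclideanSpace ℝ (Fin n)), ‖x‖ < (k : ℝ) - 1 →
      f x * (cutoff (k + 1) ‖x‖ - cutoff k ‖x‖) = 0 := by
    intro k x h
    rw [hsm k _ h.le, hsm (k + 1) _ (by push_cast; linarith)]
    simp
  refine ⟨fun k x => f x * (cutoff (k + 1) ‖x‖ - cutoff k ‖x‖), ?_, ?_, hz, ?_⟩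
  · intro k
    unfold cutoff
    fun_prop
  · intro k
    refine HasCompactSupport.intro (isCompact_closedBall 0 ((k : ℝ) + 1)) fun x hx => ?_
    have hx' : (k : ℝ) + 1 < ‖x‖ := by simpa using hx
    dsimp only
    rw [hla k _ (by linarith), hla (k + 1) _ (by push_cast; linarith)]
    simp
  · intro x
    obtain ⟨N, hN⟩ := exists_nat_gt (‖x‖ + 1)
    have h := hasSum_sum_of_ne_finset_zero (L := SummationFilter.unconditional ℕ) (s := Finset.range N)
      (f := fun k : ℕ => f x * (cutoff (k + 1) ‖x‖ - cutoff k ‖x‖)) ?_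
    · convert h using 1
      rw [← Finset.mul_sum, Finset.sum_range_sub (fun k => cutoff k ‖x‖), hsm N _ (by linarith),
        hla 0 _ (by simp)]
      simp
    · intro k hk
      have : (N : ℝ) ≤ k := by simpa using hk
      exact hz k x (by linarith)

theorem main_aux {n : ℕ} (f : EuclideanSpace ℝ (Fin n) → ℝ) (hf : Continuous f)
    (ε : ℝ) (hε : 0 < ε) :
    ∃ g : EuclideanSpace ℝ (Fin n) → ℝ,
      (∀ x, AnalyticAt ℝ g x) ∧ ∀ x, |f x - g x| ≤ ε := by
  obtain ⟨φ, hφc, hφs, hφ0, hφsum⟩ := partition_exists f hf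
  set Z := ∫ v : EuclideanSpace ℝ (Fin n), Real.exp (-‖v‖ ^ 2) with hZ
  have hZpos : 0 < Z := gauss_pos n
  have hφi : ∀ k, Integrable (φ k) := fun k => (hφc k).integrable_of_hasCompactSupport (hφs k)
  have hex : ∀ k : ℕ, ∃ σ : ℝ, 1 ≤ σ ∧
      (∫ y, |φ k y|) * (Z⁻¹ * (σ ^ n * Real.exp (-σ))) ≤ (1 / 2) ^ k ∧
      ∀ x, |φ k x - ∫ y, φ k y * (Z⁻¹ * σ ^ n) * Real.exp (-(σ ^ 2 * ‖x - y‖ ^ 2))| ≤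
        ε / 2 * (1 / 2) ^ k := by
    intro k
    have h1 := gauss_approx (φ k) (hφc k) (hφs k) (ε / 2 * (1 / 2) ^ k) (by positivity)
    have h2 : Tendsto (fun σ : ℝ => (∫ y, |φ k y|) * (Z⁻¹ * (σ ^ n * Real.exp (-σ)))) atTop
        (𝓝 ((∫ y, |φ k y|) * (Z⁻¹ * 0))) :=
      ((Real.tendsto_pow_mul_exp_neg_atTop_nhds_zero n).const_mul _).const_mul _
    simp only [mul_zero] at h2
    have h3 := h2.eventually_le_const (show (0 : ℝ) < (1 / 2) ^ k by positivity)
    obtain ⟨σ, ha, hb, hc⟩ := ((eventually_ge_atTop 1).and (h3.and h1)).exists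
    exact ⟨σ, ha, hb, hc⟩
  choose σ hσ1 hσM hσa using hex
  let b : ℕ × EuclideanSpace ℝ (Fin n) → ℝ := fun p =>
    φ p.1 p.2 * (Z⁻¹ * σ p.1 ^ n) * Real.exp (-(σ p.1 ^ 2 * ‖p.2‖ ^ 2))
  let L : ℕ × EuclideanSpace ℝ (Fin n) → (EuclideanSpace ℝ (Fin n) × ℝ →L[ℝ] ℝ) := fun p =>
    (2 * σ p.1 ^ 2) • ((innerSL ℝ p.2).comp (ContinuousLinearMap.fst ℝ _ _)) -
      (σ p.1 ^ 2) • ContinuousLinearMap.snd ℝ _ _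
  have hLn : ∀ k y, ‖L (k, y)‖ ≤ σ k ^ 2 * (2 * ‖y‖ + 1) := by
    intro k y
    refine ContinuousLinearMap.opNorm_le_bound _ (by positivity) fun v => ?_
    have e : L (k, y) v = 2 * σ k ^ 2 * inner ℝ y v.1 - σ k ^ 2 * v.2 := by simp [L]
    rw [e]
    have h1 : |inner ℝ y v.1| ≤ ‖y‖ * ‖v‖ :=
      (abs_real_inner_le_norm _ _).trans (by gcongr; exact norm_fst_le v)
    have h2 : |v.2| ≤ ‖v‖ := norm_snd_le v
    calc ‖2 * σ k ^ 2 * inner ℝ y v.1 - σ k ^ 2 * v.2‖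
        ≤ ‖2 * σ k ^ 2 * inner ℝ y v.1‖ + ‖σ k ^ 2 * v.2‖ := norm_sub_le _ _
      _ = 2 * σ k ^ 2 * |inner ℝ y v.1| + σ k ^ 2 * |v.2| := by
          simp
      _ ≤ 2 * σ k ^ 2 * (‖y‖ * ‖v‖) + σ k ^ 2 * ‖v‖ := by gcongr
      _ = _ := by ring
  have hbc : Continuous b := by
    refine continuous_prod_of_discrete_left.2 fun k => ?_
    have := hφc k
    simp only [b]
    fun_prop
  have hLc : Continuous L := by
    refine continuous_prod_of_discrete_left.2 fun k => ?_
    simp only [L]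
    have : Continuous fun y : EuclideanSpace ℝ (Fin n) => innerSL ℝ y := (innerSL ℝ).continuous
    fun_prop
  let μ : Measure (ℕ × EuclideanSpace ℝ (Fin n)) := (Measure.count).prod volume
  have hint : ∀ R : ℝ, 0 ≤ R → Integrable (fun p => |b p| * Real.exp (R * ‖L p‖)) μ := by
    intro R hR
    have hcont : Continuous (fun p => |b p| * Real.exp (R * ‖L p‖)) := by fun_prop
    have hi : ∀ k, Integrable (fun y => |b (k, y)| * Real.exp (R * ‖L (k, y)‖)) := by
      intro k
      refine Continuous.integrable_of_hasCompactSupport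
        (hcont.comp (Continuous.prodMk_right k)) ?_
      refine (hφs k).mono fun y hy => ?_
      simp only [Function.mem_support] at hy ⊢
      intro h0
      exact hy (by simp [b, h0])
    refine (integrable_prod_iff hcont.aestronglyMeasurable).2 ⟨ae_of_all _ hi, ?_⟩
    rw [integrable_count_iff]
    refine Summable.of_norm_bounded_eventually_nat summable_geometric_two ?_
    obtain ⟨N, hN⟩ := exists_nat_gt (2 * R + 3)
    filter_upwards [eventually_ge_atTop N] with k hk
    have hk' : 2 * R + 3 < k := hN.trans_le (by exact_mod_cast hk)
    rw [norm_norm, Real.norm_of_nonneg (integral_nonneg fun _ => norm_nonneg _)]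
    refine le_trans ?_ (hσM k)
    rw [← integral_mul_const]
    refine integral_mono (hi k).norm ((hφi k).abs.mul_const _) fun y => ?_
    have hσ0 : 0 < σ k := zero_lt_one.trans_le (hσ1 k)
    dsimp only
    rw [Real.norm_of_nonneg (by positivity)]
    by_cases hy : ‖y‖ < (k : ℝ) - 1
    · simp [b, hφ0 k y hy]
    · push Not at hy
      have hb : |b (k, y)| = |φ k y| * (Z⁻¹ * σ k ^ n) * Real.exp (-(σ k ^ 2 * ‖y‖ ^ 2)) := by
        simp only [b, abs_mul, Real.abs_exp]
        rw [abs_of_pos (inv_pos.2 hZpos), abs_of_pos (pow_pos hσ0 n)]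
      rw [hb, mul_assoc, ← Real.exp_add, mul_assoc, mul_assoc]
      gcongr
      have h1 : R * ‖L (k, y)‖ ≤ R * (σ k ^ 2 * (2 * ‖y‖ + 1)) := by gcongr; exact hLn k y
      have h2 : 1 ≤ ‖y‖ ^ 2 - 2 * R * ‖y‖ - R := by nlinarith
      have h3 : σ k ≤ σ k ^ 2 := by nlinarith [hσ1 k]
      nlinarith [mul_le_mul_of_nonneg_left h2 (sq_nonneg (σ k))]
  have hA := laplace_analytic μ b hbc.aestronglyMeasurable L hLc.aestronglyMeasurable hint
  refine ⟨fun x => ∫ p, b p * Real.exp (L p (x, ‖x‖ ^ 2)) ∂μ, ?_, ?_⟩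
  · intro x
    have h1 : AnalyticAt ℝ (fun x : EuclideanSpace ℝ (Fin n) => ‖x‖ ^ 2) x :=
      (contDiff_norm_sq ℝ (n := ⊤)).contDiffAt.analyticAt
    have h2 : AnalyticAt ℝ (fun x : EuclideanSpace ℝ (Fin n) => (x, ‖x‖ ^ 2)) x :=
      analyticAt_id.prod h1
    exact AnalyticAt.fun_comp (f := fun x : EuclideanSpace ℝ (Fin n) => (x, ‖x‖ ^ 2)) (hA (x, ‖x‖ ^ 2)) h2
  · intro x
    have hI : Integrable (fun p => b p * Real.exp (L p (x, ‖x‖ ^ 2))) μ := by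
      refine (hint ‖(x, ‖x‖ ^ 2)‖ (norm_nonneg _)).mono'
        (Continuous.aestronglyMeasurable (by fun_prop)) (ae_of_all _ fun p => ?_)
      rw [norm_mul, Real.norm_eq_abs, Real.norm_eq_abs, Real.abs_exp]
      gcongr
      refine (le_abs_self _).trans (((L p).le_opNorm _).trans (le_of_eq (mul_comm _ _)))
    have hbL : ∀ k y, b (k, y) * Real.exp (L (k, y) (x, ‖x‖ ^ 2)) =
        φ k y * (Z⁻¹ * σ k ^ n) * Real.exp (-(σ k ^ 2 * ‖x - y‖ ^ 2)) := by
      intro k y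
      simp only [b]
      rw [mul_assoc, ← Real.exp_add]
      congr 2
      simp only [L]
      rw [norm_sub_sq_real, real_inner_comm]
      simp
      ring
    have hs : HasSum (fun k => ∫ y, φ k y * (Z⁻¹ * σ k ^ n) *
        Real.exp (-(σ k ^ 2 * ‖x - y‖ ^ 2))) (∫ p, b p * Real.exp (L p (x, ‖x‖ ^ 2)) ∂μ) := by
      have hI2 := hI.integral_prod_left
      have hsm := (integrable_count_iff.1 hI2).of_norm.hasSum
      have e : ∫ p, b p * Real.exp (L p (x, ‖x‖ ^ 2)) ∂μ =
          ∑' k : ℕ, ∫ y, b (k, y) * Real.exp (L (k, y) (x, ‖x‖ ^ 2)) := by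
        rw [integral_prod _ hI, integral_countable hI2]
        simp [measureReal_def]
      rw [e]
      simpa only [hbL] using hsm
    have hd := (hφsum x).sub hs
    rw [← hd.tsum_eq, ← Real.norm_eq_abs]
    have hg : HasSum (fun k : ℕ => ε / 2 * (1 / 2 : ℝ) ^ k) ε := by
      have := hasSum_geometric_two.mul_left (ε / 2)
      simpa using this
    exact tsum_of_norm_bounded hg fun k => hσa k x



theorem stmt_11 {n : ℕ} (f : EuclideanSpace ℝ (Fin n) → ℝ) (hf : Continuous f)
    (ε : ℝ) (hε : 0 < ε) :
    ∃ g : EuclideanSpace ℝ (Fin n) → ℝ,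
      (∀ x, AnalyticAt ℝ g x) ∧ ∀ x, |f x - g x| ≤ ε := by
  exact main_aux f hf ε hε
end
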